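/- arXiv:2203.08531 — 8 statements merged into one kernel-verified Lean document; each statement's English description precedes it below -/
import Mathlib

section
/- The space (𝓜, ρ) is a complete (pseudo)metric space: for every sequence (fₙ) in 𝓜 that is Cauchy with respect to ρ, i.e. sup_{t∈ℝ} 𝔼[max_{1≤i≤d} |fₙ,ᵢ(t,·) − f_m,ᵢ(t,·)|] → 0 as n, m → ∞, there exists f ∈ 𝓜 such that ρ(fₙ, f) → 0 as n → ∞. -/
open MeasureTheory Filter

theorem iSup_abs_eq_norm {ι : Type*} [Fintype ι] (x : ι → ℝ) : ⨆ i, |x i| = ‖x‖ := by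
  refine le_antisymm (Real.iSup_le (fun i => norm_le_pi_norm x i) (norm_nonneg x)) ?_
  exact (pi_norm_le_iff_of_nonneg (Real.iSup_nonneg fun i => abs_nonneg _)).2
    fun i => le_ciSup (f := fun i => |x i|) (Set.finite_range _).bddAbove i

theorem norm_sub_le_of_mem_Icc_zero {ι : Type*} [Fintype ι] {N x y : ι → ℝ}
    (hx : x ∈ Set.Icc 0 N) (hy : y ∈ Set.Icc 0 N) : ‖x - y‖ ≤ ‖N‖ := by
  refine (pi_norm_le_iff_of_nonneg (norm_nonneg N)).2 fun i => ?_
  refine le_trans ?_ ((le_abs_self _).trans (norm_le_pi_norm N i))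
  have h₁ := hx.1 i
  have h₂ := hx.2 i
  have h₃ := hy.1 i
  have h₄ := hy.2 i
  simp only [Pi.zero_apply] at h₁ h₃
  rw [Pi.sub_apply, Real.norm_eq_abs, abs_le]
  constructor <;> linarith

theorem limsup_mem_Icc {a b : ℝ} {u : ℕ → ℝ} (hu : ∀ k, u k ∈ Set.Icc a b) :
    limsup u atTop ∈ Set.Icc a b := by
  have hle : IsBoundedUnder (· ≤ ·) atTop u := isBoundedUnder_of ⟨b, fun k => (hu k).2⟩
  have hge : IsBoundedUnder (· ≥ ·) atTop u := isBoundedUnder_of ⟨a, fun k => (hu k).1⟩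
  exact ⟨le_limsup_of_frequently_le (Frequently.of_forall fun k => (hu k).1) hle,
    limsup_le_of_le hge.isCoboundedUnder_le (Eventually.of_forall fun k => (hu k).2)⟩

/-- The componentwise upper limit of strongly progressive processes is strongly progressive. -/
theorem isStronglyProgressive_limsup {Ω ι κ : Type*} [Fintype κ] [Preorder ι]
    [MeasurableSpace ι] {mΩ : MeasurableSpace Ω} {𝓕 : Filtration ι mΩ}
    {u : ℕ → ι → Ω → κ → ℝ} (hu : ∀ k, IsStronglyProgressive 𝓕 (u k)) :
    IsStronglyProgressive 𝓕 fun t ω i => limsup (fun k => u k t ω i) atTop := by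
  intro t
  let _ : MeasurableSpace (Set.Iic t × Ω) := Subtype.instMeasurableSpace.prod (𝓕 t)
  refine Measurable.stronglyMeasurable (measurable_pi_iff.2 fun i => ?_)
  exact Measurable.limsup fun k => measurable_pi_iff.1 (hu k t).measurable i

/-- A sequence in `L¹` whose tails have `L¹`-diameter at most `2⁻ᵏ` converges almost everywhere
to its componentwise upper limit. -/
theorem ae_tendsto_limsup_of_integral_norm_sub_le {Ω κ : Type*} [Fintype κ]
    {mΩ : MeasurableSpace Ω} {μ : Measure Ω} {u : ℕ → Ω → κ → ℝ}
    (hu : ∀ k, Integrable (u k) μ)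
    (h : ∀ k n m, k ≤ n → k ≤ m → ∫ ω, ‖u n ω - u m ω‖ ∂μ < (1 / 2) ^ k) :
    ∀ᵐ ω ∂μ, Tendsto (fun k => u k ω) atTop
      (nhds fun i => limsup (fun k => u k ω i) atTop) := by
  have hsum : ∑' k : ℕ, ENNReal.ofReal ((1 / 2) ^ k) ≠ ⊤ :=
    summable_geometric_two.tsum_ofReal_ne_top
  have hconv : ∀ᵐ ω ∂μ, ∃ l, Tendsto (fun k => u k ω) atTop (nhds l) := by
    refine Lp.ae_tendsto_of_cauchy_eLpNorm (p := 1) (fun k => (hu k).aestronglyMeasurable) le_rfl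
      hsum fun k n m hn hm => ?_
    rw [eLpNorm_one_eq_lintegral_enorm,
      ← ofReal_integral_norm_eq_lintegral_enorm ((hu n).sub (hu m))]
    exact (ENNReal.ofReal_lt_ofReal_iff (by positivity)).2 (h k n m hn hm)
  filter_upwards [hconv] with ω ⟨l, hl⟩
  convert hl using 2
  ext i
  exact (tendsto_pi_nhds.1 hl i).limsup_eq

theorem exists_tendsto_atTop_forall_le (a : ℕ → ℕ) :
    ∃ φ : ℕ → ℕ, Tendsto φ atTop atTop ∧ ∀ k n, k ≤ n → a k ≤ φ n :=
  ⟨fun n => n + (Finset.range (n + 1)).sup a,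
    tendsto_atTop_mono (fun n => Nat.le_add_right n _) tendsto_id,
    fun _ _ hk => le_add_left (Finset.le_sup (Finset.mem_range.2 (Nat.lt_succ_of_le hk)))⟩

/-- Completeness of the space `(𝓜, ρ)`: `𝓜` is the set of `[0,N]`-valued processes,
progressively measurable with respect to `(𝓕 t)_{t∈ℝ}`, satisfying
`f(t+T, ω) = f(t, θ_T ω)`, with `ρ(f₁,f₂) = sup_{t∈ℝ} 𝔼[max_i |f₁,ᵢ(t,·) − f₂,ᵢ(t,·)|]`.
Every `ρ`-Cauchy sequence in `𝓜` converges in `ρ` to some element of `𝓜`. -/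
theorem stmt_0 {Ω : Type*} [mΩ : MeasurableSpace Ω] (ℙ : Measure Ω)
    [IsProbabilityMeasure ℙ]
    (𝓕 : Filtration ℝ mΩ)
    (d : ℕ) (hd : 1 ≤ d) (T : ℝ) (hT : 0 < T)
    (θT : Ω → Ω) (hθT : Measurable θT)
    (N : Fin d → ℝ) (hN : ∀ i, 0 ≤ N i)
    (Mmem : (ℝ → Ω → (Fin d → ℝ)) → Prop)
    (hMmem : ∀ f, Mmem f ↔
      (ProgMeasurable 𝓕 f ∧ (∀ t ω i, 0 ≤ f t ω i ∧ f t ω i ≤ N i) ∧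
        ∀ t ω, f (t + T) ω = f t (θT ω)))
    (ρ : (ℝ → Ω → (Fin d → ℝ)) → (ℝ → Ω → (Fin d → ℝ)) → ℝ)
    (hρ : ∀ f₁ f₂, ρ f₁ f₂ = ⨆ t : ℝ, ∫ ω, (⨆ i : Fin d, |f₁ t ω i - f₂ t ω i|) ∂ℙ)
    (f : ℕ → ℝ → Ω → (Fin d → ℝ)) (hf : ∀ n, Mmem (f n))
    (hcauchy : ∀ ε : ℝ, 0 < ε → ∃ M₀ : ℕ, ∀ n m : ℕ, M₀ ≤ n → M₀ ≤ m →
      ρ (f n) (f m) < ε) :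
    ∃ g, Mmem g ∧ Tendsto (fun n => ρ (f n) g) atTop (nhds 0) := by
  simp only [hMmem] at hf
  simp only [← Pi.sub_apply, iSup_abs_eq_norm] at hρ
  have hIcc : ∀ n t ω, f n t ω ∈ Set.Icc 0 N := fun n t ω =>
    ⟨fun i => ((hf n).2.1 t ω i).1, fun i => ((hf n).2.1 t ω i).2⟩
  have hmeas : ∀ n t, AEStronglyMeasurable (f n t) ℙ := fun n t =>
    ((IsStronglyProgressive.stronglyAdapted (hf n).1 t).mono (𝓕.le t)).aestronglyMeasurable
  have hint : ∀ n t, Integrable (f n t) ℙ := fun n t =>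
    Integrable.of_bound (hmeas n t) ‖N‖ (Eventually.of_forall fun ω => by
      simpa using norm_sub_le_of_mem_Icc_zero (hIcc n t ω) (Set.left_mem_Icc.2 hN))
  have hle : ∀ n m t, ∫ ω, ‖f n t ω - f m t ω‖ ∂ℙ ≤ ρ (f n) (f m) := by
    intro n m t
    rw [hρ]
    refine le_ciSup (f := fun t => ∫ ω, ‖f n t ω - f m t ω‖ ∂ℙ) ⟨‖N‖, ?_⟩ t
    rintro _ ⟨s, rfl⟩
    calc ∫ ω, ‖f n s ω - f m s ω‖ ∂ℙ ≤ ∫ _, ‖N‖ ∂ℙ :=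
          integral_mono ((hint n s).sub (hint m s)).norm (integrable_const _)
            fun ω => norm_sub_le_of_mem_Icc_zero (hIcc n s ω) (hIcc m s ω)
      _ = ‖N‖ := by simp
  choose a ha using fun k : ℕ => hcauchy ((1 / 2) ^ k) (by positivity)
  obtain ⟨φ, hφ_top, hφ⟩ := exists_tendsto_atTop_forall_le a
  have hlim : ∀ t, ∀ᵐ ω ∂ℙ, Tendsto (fun k => f (φ k) t ω) atTop
      (nhds fun i => limsup (fun k => f (φ k) t ω i) atTop) := fun t =>
    ae_tendsto_limsup_of_integral_norm_sub_le (fun k => hint (φ k) t) fun k n m hn hm =>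
      (hle _ _ t).trans_lt (ha k _ _ (hφ k n hn) (hφ k m hm))
  refine ⟨fun t ω i => limsup (fun k => f (φ k) t ω i) atTop, (hMmem _).2 ⟨?_, ?_, ?_⟩, ?_⟩
  · exact isStronglyProgressive_limsup fun k => (hf (φ k)).1
  · exact fun t ω i => limsup_mem_Icc fun k => (hf (φ k)).2.1 t ω i
  · intro t ω
    simp only [(hf _).2.2 t ω]
  · rw [Metric.tendsto_atTop]
    intro ε hε
    obtain ⟨M, hM⟩ := hcauchy (ε / 2) (half_pos hε)
    refine ⟨M, fun n hn => ?_⟩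
    rw [hρ, Real.dist_0_eq_abs, abs_of_nonneg
      (Real.iSup_nonneg fun t => integral_nonneg fun ω => norm_nonneg _)]
    refine lt_of_le_of_lt (Real.iSup_le (fun t => ?_) (half_pos hε).le) (half_lt_self hε)
    have hconv := tendsto_integral_of_dominated_convergence (μ := ℙ)
      (F := fun k ω => ‖f n t ω - f (φ k) t ω‖) (fun _ => ‖N‖)
      (fun k => ((hint n t).sub (hint (φ k) t)).norm.aestronglyMeasurable)
      (integrable_const _)
      (fun k => Eventually.of_forall fun ω => by
        simpa using norm_sub_le_of_mem_Icc_zero (hIcc n t ω) (hIcc (φ k) t ω))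
      ((hlim t).mono fun ω h => (tendsto_const_nhds.sub h).norm)
    exact le_of_tendsto hconv ((hφ_top.eventually_ge_atTop M).mono
      fun k hk => (hle n (φ k) t).trans (hM _ _ hn hk).le)
end

section
/- For every bounded measurable v : ℝ × Ω → [0,∞)ᵈ, every t ∈ ℝ and every ω ∈ Ω, the integral defining K(v)(t, ω) converges absolutely: ∫_{−∞}^{t} |Φ(t−s, θ_s ω) v(s, ω)|₂ ds < ∞, where |·|₂ denotes the Euclidean norm on ℝᵈ; in particular the input-to-state characteristic operator K is well defined. -/
open MeasureTheory Filter

/-- The Euclidean norm of a vector in `ℝᵈ` is at most `√d` times any bound on its entries. -/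
theorem sqrt_sum_sq_le_sqrt_card_mul {d : ℕ} {x : Fin d → ℝ} {M : ℝ} (hM : 0 ≤ M)
    (hx : ∀ i, |x i| ≤ M) : √(∑ i, x i ^ 2) ≤ √d * M := by
  rw [← Real.sqrt_sq hM, ← Real.sqrt_mul d.cast_nonneg]
  refine Real.sqrt_le_sqrt ?_
  calc ∑ i, x i ^ 2 ≤ ∑ _i : Fin d, M ^ 2 :=
        Finset.sum_le_sum fun i _ => sq_le_sq' (abs_le.1 (hx i)).1 (abs_le.1 (hx i)).2
    _ = d * M ^ 2 := by simp

/-- Entrywise bounds on a matrix and a vector bound the entries of their product. -/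
theorem Matrix.abs_mulVec_le {d : ℕ} {A : Matrix (Fin d) (Fin d) ℝ} {x : Fin d → ℝ} {a b : ℝ}
    (hA : ∀ i j, |A i j| ≤ a) (hx : ∀ j, |x j| ≤ b) (i : Fin d) :
    |A.mulVec x i| ≤ d * (a * b) := by
  calc |A.mulVec x i| ≤ ∑ j, |A i j * x j| := by
        simp only [Matrix.mulVec, dotProduct]
        exact Finset.abs_sum_le_sum_abs _ _
    _ ≤ ∑ _j : Fin d, a * b := by
        refine Finset.sum_le_sum fun j _ => ?_
        rw [abs_mul]
        exact mul_le_mul (hA i j) (hx j) (abs_nonneg _) ((abs_nonneg _).trans (hA i j))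
    _ = d * (a * b) := by simp

/-- A growth rate `γ` of the prefactor at time `s ≤ t` still leaves decay at rate `γ`
from an exponential decay of rate `2 * γ`. -/
theorem mul_exp_neg_le_of_exp_neg_abs_mul_le {γ r C s t : ℝ} (hγ : 0 ≤ γ) (hC : 0 ≤ C)
    (hst : s ≤ t) (h : Real.exp (-γ * |s|) * r ≤ C) :
    r * Real.exp (-(2 * γ) * (t - s)) ≤
      C * Real.exp (γ * |t| - γ * t) * Real.exp (γ * s) := by
  have habs : |s| ≤ |t| + (t - s) := by
    have := abs_sub_abs_le_abs_sub s t
    rw [abs_of_nonpos (sub_nonpos.2 hst)] at this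
    linarith
  have hr : r ≤ C * Real.exp (γ * |s|) := by
    have := mul_le_mul_of_nonneg_right h (Real.exp_pos (γ * |s|)).le
    rwa [mul_right_comm, ← Real.exp_add, neg_mul, neg_add_cancel, Real.exp_zero, one_mul] at this
  calc r * Real.exp (-(2 * γ) * (t - s))
      ≤ C * Real.exp (γ * |s|) * Real.exp (-(2 * γ) * (t - s)) := by gcongr
    _ = C * Real.exp (γ * |s| + -(2 * γ) * (t - s)) := by rw [mul_assoc, ← Real.exp_add]
    _ ≤ C * Real.exp (γ * |t| - γ * t + γ * s) := by
        refine mul_le_mul_of_nonneg_left (Real.exp_le_exp.2 ?_) hC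
        linarith [mul_le_mul_of_nonneg_left habs hγ]
    _ = _ := by rw [Real.exp_add, mul_assoc]

/-- The input-to-state characteristic operator `K` is well defined: under the tempered
exponential bound `|Φ_{ij}(t,ω)| ≤ R(t,ω)e^{−λt}` on the fundamental matrix, for every
bounded measurable nonnegative input `v`, every `t ∈ ℝ` and every `ω ∈ Ω`, the integral
defining `K(v)(t,ω)` converges absolutely:
`∫_{−∞}^{t} |Φ(t−s, θ_s ω) v(s,ω)|₂ ds < ∞` (Euclidean norm `|·|₂` on `ℝᵈ`). -/
theorem stmt_1 {Ω : Type*} [mΩ : MeasurableSpace Ω] (ℙ : Measure Ω)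
    [IsProbabilityMeasure ℙ]
    (θ : ℝ → Ω → Ω)
    (hθmeas : Measurable fun p : ℝ × Ω => θ p.1 p.2)
    (hθ0 : θ 0 = id) (hθadd : ∀ s t : ℝ, θ (t + s) = θ t ∘ θ s)
    (hθpres : ∀ t, MeasurePreserving (θ t) ℙ ℙ)
    (d : ℕ) (hd : 1 ≤ d) (lam : ℝ) (hlam : 0 < lam)
    (Φ : ℝ → Ω → Matrix (Fin d) (Fin d) ℝ)
    (hΦmeas : ∀ i j, Measurable fun p : ℝ × Ω => Φ p.1 p.2 i j)
    (hΦpos : ∀ t ω, 0 ≤ t → ∀ i j, 0 ≤ Φ t ω i j)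
    (R : ℝ → Ω → ℝ)
    (hRmeas : Measurable fun p : ℝ × Ω => R p.1 p.2)
    (hRpos : ∀ t ω, 0 ≤ t → 0 < R t ω)
    (hΦbound : ∀ t ω, 0 ≤ t → ∀ i j, |Φ t ω i j| ≤ R t ω * Real.exp (-lam * t))
    (hRtemp : ∀ γ : ℝ, 0 < γ → ∀ ω, ∃ C : ℝ, ∀ t s : ℝ, 0 ≤ s →
      Real.exp (-γ * |t|) * R s (θ t ω) ≤ C)
    (v : ℝ → Ω → (Fin d → ℝ))
    (hvmeas : Measurable fun p : ℝ × Ω => v p.1 p.2)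
    (hvpos : ∀ t ω i, 0 ≤ v t ω i)
    (hvbdd : ∃ B : ℝ, ∀ t ω i, v t ω i ≤ B)
    (t : ℝ) (ω : Ω) :
    ∫⁻ s in Set.Iic t,
      ENNReal.ofReal (Real.sqrt (∑ i, ((Φ (t - s) (θ s ω)).mulVec (v s ω) i) ^ 2)) < ⊤ := by
  obtain ⟨B, hB⟩ := hvbdd
  obtain ⟨C, hC⟩ := hRtemp (lam / 2) (half_pos hlam) ω
  have hB0 : 0 ≤ B := (hvpos 0 ω ⟨0, hd⟩).trans (hB 0 ω ⟨0, hd⟩)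
  have hC0 : 0 ≤ C :=
    (mul_pos (Real.exp_pos _) (hRpos 0 (θ 0 ω) le_rfl)).le.trans (hC 0 0 le_rfl)
  set D : ℝ := C * Real.exp (lam / 2 * |t| - lam / 2 * t)
  have hD0 : 0 ≤ D := by positivity
  have hΦD : ∀ s ≤ t, ∀ i j, |Φ (t - s) (θ s ω) i j| ≤ D * Real.exp (lam / 2 * s) := by
    intro s hs i j
    have hts := sub_nonneg.2 hs
    refine (hΦbound _ _ hts i j).trans ?_
    have := mul_exp_neg_le_of_exp_neg_abs_mul_le (half_pos hlam).le hC0 hs (hC s (t - s) hts)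
    rwa [mul_div_cancel₀ lam two_ne_zero] at this
  have hint : IntegrableOn (fun s => √d * (d * (D * Real.exp (lam / 2 * s) * B))) (Set.Iic t) :=
    (((((integrableOn_exp_mul_Iic (half_pos hlam) t).const_mul D).mul_const B).const_mul
      (d : ℝ)).const_mul (√d))
  refine lt_of_le_of_lt (setLIntegral_mono' measurableSet_Iic fun s hs => ?_)
    hint.lintegral_lt_top
  refine ENNReal.ofReal_le_ofReal (sqrt_sum_sq_le_sqrt_card_mul (by positivity) ?_)
  exact Matrix.abs_mulVec_le (hΦD s hs) fun j => by
    rw [abs_of_nonneg (hvpos s ω j)]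
    exact hB s ω j
end

section
/- For all f₁, f₂ ∈ 𝓜 the gain operator satisfies ρ(K^h(f₁), K^h(f₂)) ≤ (L·d²/λ)·(sup_{t≥0} 𝔼[R(t,·)])·ρ(f₁, f₂). In particular, if L·d²·sup_{t≥0} 𝔼[R(t,·)] < λ, then K^h : (𝓜, ρ) → (𝓜, ρ) is a contractive mapping. -/
open MeasureTheory Filter

lemma iSup_abs_sub_eq_norm {ι : Type*} [Fintype ι] (a b : ι → ℝ) :
    (⨆ i, |a i - b i|) = ‖a - b‖ := by
  refine le_antisymm (Real.iSup_le (fun i => norm_le_pi_norm (a - b) i) (norm_nonneg _)) ?_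
  refine (pi_norm_le_iff_of_nonneg (Real.iSup_nonneg fun i => abs_nonneg _)).2 fun i => ?_
  exact le_ciSup (f := fun i => |a i - b i|) (Set.finite_range _).bddAbove i

lemma norm_mulVec_le_of_abs_le {d : ℕ} {A : Matrix (Fin d) (Fin d) ℝ} {r : ℝ} (hr : 0 ≤ r)
    (hA : ∀ i j, |A i j| ≤ r) (v : Fin d → ℝ) : ‖A.mulVec v‖ ≤ d * (r * ‖v‖) := by
  refine (pi_norm_le_iff_of_nonneg (by positivity)).2 fun i => ?_
  calc ‖A.mulVec v i‖ ≤ ∑ j, ‖A i j * v j‖ :=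
        norm_sum_le Finset.univ fun j => A i j * v j
    _ ≤ ∑ _j : Fin d, r * ‖v‖ := Finset.sum_le_sum fun j _ => by
        rw [norm_mul]
        exact mul_le_mul (hA i j) (norm_le_pi_norm v j) (norm_nonneg _) hr
    _ = d * (r * ‖v‖) := by simp

/-- A map of the nonnegative orthant with partial derivatives bounded by `L` is
`L * d`-Lipschitz for the sup norm. -/
lemma norm_sub_le_of_abs_fderiv_le {d : ℕ} {g : (Fin d → ℝ) → (Fin d → ℝ)} {L : ℝ} (hL : 0 ≤ L)
    (hg : ∀ x i, DifferentiableAt ℝ (fun y => g y i) x)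
    (hLg : ∀ x, (∀ j, 0 ≤ x j) → ∀ i j,
      |fderiv ℝ (fun y => g y i) x (Pi.single j 1)| ≤ L)
    {x y : Fin d → ℝ} (hx : ∀ j, 0 ≤ x j) (hy : ∀ j, 0 ≤ y j) :
    ‖g x - g y‖ ≤ L * d * ‖x - y‖ := by
  refine (pi_norm_le_iff_of_nonneg (by positivity)).2 fun i => ?_
  have hconv : Convex ℝ (Set.Ici (0 : Fin d → ℝ)) := convex_Ici 0
  obtain ⟨z, hz, hzeq⟩ := domain_mvt (f := fun y => g y i)
    (fun w _ => (hg w i).hasFDerivAt.hasFDerivWithinAt) hconv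
    (show y ∈ Set.Ici (0 : Fin d → ℝ) from hy) (show x ∈ Set.Ici (0 : Fin d → ℝ) from hx)
  have hz0 : ∀ j, 0 ≤ z j := hconv.segment_subset hy hx hz
  have hsum := (fderiv ℝ (fun y => g y i) z).toLinearMap.pi_apply_eq_sum_univ (x - y)
  rw [Pi.sub_apply, hzeq]
  have hsum' : fderiv ℝ (fun y => g y i) z (x - y) =
      ∑ j, (x - y) j * fderiv ℝ (fun y => g y i) z (Pi.single j 1) := by
    refine hsum.trans (Finset.sum_congr rfl fun j _ => ?_)
    have : (fun k => if j = k then (1 : ℝ) else 0) = Pi.single j 1 := by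
      ext k
      simp [Pi.single_apply, eq_comm]
    rw [this]
    rfl
  rw [hsum']
  calc ‖∑ j, (x - y) j * fderiv ℝ (fun y => g y i) z (Pi.single j 1)‖
      ≤ ∑ j, ‖(x - y) j * fderiv ℝ (fun y => g y i) z (Pi.single j 1)‖ := norm_sum_le _ _
    _ ≤ ∑ _j : Fin d, ‖x - y‖ * L := Finset.sum_le_sum fun j _ => by
        rw [norm_mul]
        exact mul_le_mul (norm_le_pi_norm _ j) (hLg z hz0 i j) (norm_nonneg _) (norm_nonneg _)
    _ = L * d * ‖x - y‖ := by simp; ring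

lemma IsStronglyProgressive.measurable_comp_min {Ω E : Type*} {mΩ : MeasurableSpace Ω}
    [TopologicalSpace E] [TopologicalSpace.PseudoMetrizableSpace E] [MeasurableSpace E]
    [BorelSpace E] {𝓕 : Filtration ℝ mΩ} {f : ℝ → Ω → E} (hf : IsStronglyProgressive 𝓕 f) (t : ℝ) :
    Measurable fun p : ℝ × Ω => f (min p.1 t) p.2 := by
  have hft := (hf t).measurable.mono
    (sup_le_sup le_rfl (MeasurableSpace.comap_mono (𝓕.le t))) le_rfl
  have hproj : Measurable fun p : ℝ × Ω =>
      ((⟨min p.1 t, Set.mem_Iic.2 (min_le_right _ _)⟩ : Set.Iic t), p.2) := by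
    fun_prop
  exact hft.comp hproj

lemma lintegral_Iic_exp_neg_mul_sub {lam : ℝ} (hlam : 0 < lam) (t : ℝ) :
    ∫⁻ s in Set.Iic t, ENNReal.ofReal (Real.exp (-lam * (t - s))) = ENNReal.ofReal (1 / lam) := by
  have hexp : ∀ s, Real.exp (-lam * (t - s)) = Real.exp (-lam * t) * Real.exp (lam * s) :=
    fun s => by rw [← Real.exp_add]; ring_nf
  simp_rw [hexp]
  rw [← ofReal_integral_eq_lintegral_ofReal ((integrableOn_exp_mul_Iic hlam t).const_mul _)
    (ae_of_all _ fun s => by positivity), integral_const_mul, integral_exp_mul_Iic hlam,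
    mul_div_assoc', ← Real.exp_add]
  simp

/-- A subexponentially growing weight does not destroy the integrability at `-∞` of an
exponentially decaying kernel. -/
lemma integrableOn_Iic_mulVec {d : ℕ} {lam : ℝ} (hlam : 0 < lam) {t B C : ℝ}
    {A : ℝ → Matrix (Fin d) (Fin d) ℝ} {r : ℝ → ℝ} {v : ℝ → Fin d → ℝ}
    (hA : ∀ i j, Measurable fun s => A s i j)
    (hv : AEStronglyMeasurable v (volume.restrict (Set.Iic t)))
    (hvB : ∀ s, ‖v s‖ ≤ B)
    (hr0 : ∀ s ≤ t, 0 ≤ r s)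
    (hAr : ∀ s ≤ t, ∀ i j, |A s i j| ≤ r s * Real.exp (-lam * (t - s)))
    (hrC : ∀ s ≤ t, Real.exp (-(lam / 2) * |s|) * r s ≤ C) :
    IntegrableOn (fun s => (A s).mulVec (v s)) (Set.Iic t) := by
  have hB : 0 ≤ B := (norm_nonneg _).trans (hvB 0)
  have hdom := (integrableOn_exp_mul_Iic (half_pos hlam) t).const_mul
    (d * (C * Real.exp (lam * |t| - lam * t) * B))
  refine hdom.mono' ?_ ?_
  · refine AEMeasurable.aestronglyMeasurable (aemeasurable_pi_lambda _ fun i => ?_)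
    simp only [Matrix.mulVec, dotProduct]
    refine Finset.aemeasurable_fun_sum _ fun j _ => ?_
    exact (hA i j).aemeasurable.mul ((aemeasurable_pi_iff.1 hv.aemeasurable) j)
  · filter_upwards [ae_restrict_mem measurableSet_Iic] with s hs
    have hs : s ≤ t := hs
    have hrs := hr0 s hs
    have habs : |s| ≤ 2 * |t| - s := by
      rcases abs_cases s with h | h <;> rcases abs_cases t with h' | h' <;> linarith
    have hrexp : r s ≤ C * Real.exp (lam / 2 * |s|) := by
      have h1 := mul_le_mul_of_nonneg_right (hrC s hs) (Real.exp_nonneg (lam / 2 * |s|))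
      have h2 : Real.exp (-(lam / 2) * |s|) * r s * Real.exp (lam / 2 * |s|) = r s := by
        rw [mul_right_comm, ← Real.exp_add]
        simp
      rwa [h2] at h1
    have hC : 0 ≤ C := (by positivity : 0 ≤ Real.exp (-(lam / 2) * |s|) * r s).trans (hrC s hs)
    have hker : r s * Real.exp (-lam * (t - s)) ≤
        C * Real.exp (lam * |t| - lam * t) * Real.exp (lam / 2 * s) := by
      calc r s * Real.exp (-lam * (t - s))
          ≤ C * Real.exp (lam / 2 * |s|) * Real.exp (-lam * (t - s)) := by gcongr
        _ = C * Real.exp (lam / 2 * |s| + -lam * (t - s)) := by rw [Real.exp_add]; ring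
        _ ≤ C * Real.exp ((lam * |t| - lam * t) + lam / 2 * s) := by
            refine mul_le_mul_of_nonneg_left (Real.exp_le_exp.2 ?_) hC
            nlinarith
        _ = _ := by rw [Real.exp_add]; ring
    calc ‖(A s).mulVec (v s)‖ ≤ d * (r s * Real.exp (-lam * (t - s)) * ‖v s‖) :=
          norm_mulVec_le_of_abs_le (by positivity) (hAr s hs) _
      _ ≤ d * (C * Real.exp (lam * |t| - lam * t) * Real.exp (lam / 2 * s) * B) := by
          gcongr
          exact hvB s
      _ = _ := by ring

/-- Contraction estimate for the gain operator: for all `f₁, f₂ ∈ 𝓜`,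
`ρ(K^h(f₁), K^h(f₂)) ≤ (L·d²/λ)·(sup_{t≥0} 𝔼[R(t,·)])·ρ(f₁, f₂)`; in particular, if
`L·d²·sup_{t≥0} 𝔼[R(t,·)] < λ` then `K^h : (𝓜, ρ) → (𝓜, ρ)` is a contraction. -/
theorem stmt_3 {Ω : Type*} [mΩ : MeasurableSpace Ω] (ℙ : Measure Ω)
    [IsProbabilityMeasure ℙ]
    (θ : ℝ → Ω → Ω)
    (hθmeas : Measurable fun p : ℝ × Ω => θ p.1 p.2)
    (hθ0 : θ 0 = id) (hθadd : ∀ s t : ℝ, θ (t + s) = θ t ∘ θ s)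
    (hθpres : ∀ t, MeasurePreserving (θ t) ℙ ℙ)
    (d : ℕ) (hd : 1 ≤ d) (lam : ℝ) (hlam : 0 < lam)
    (Φ : ℝ → Ω → Matrix (Fin d) (Fin d) ℝ)
    (hΦmeas : ∀ i j, Measurable fun p : ℝ × Ω => Φ p.1 p.2 i j)
    (hΦpos : ∀ t ω, 0 ≤ t → ∀ i j, 0 ≤ Φ t ω i j)
    (R : ℝ → Ω → ℝ)
    (hRmeas : Measurable fun p : ℝ × Ω => R p.1 p.2)
    (hRpos : ∀ t ω, 0 ≤ t → 0 < R t ω)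
    (hΦbound : ∀ t ω, 0 ≤ t → ∀ i j, |Φ t ω i j| ≤ R t ω * Real.exp (-lam * t))
    (hRtemp : ∀ γ : ℝ, 0 < γ → ∀ ω, ∃ C : ℝ, ∀ t s : ℝ, 0 ≤ s →
      Real.exp (-γ * |t|) * R s (θ t ω) ≤ C)
    (K : (ℝ → Ω → (Fin d → ℝ)) → ℝ → Ω → (Fin d → ℝ))
    (hK : ∀ v t ω, K v t ω = ∫ s in Set.Iic t, (Φ (t - s) (θ s ω)).mulVec (v s ω))
    (T : ℝ) (hT : 0 < T)
    (h : ℝ → (Fin d → ℝ) → (Fin d → ℝ))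
    (hhcont : Continuous fun p : ℝ × (Fin d → ℝ) => h p.1 p.2)
    (hhdiff : ∀ t x i, DifferentiableAt ℝ (fun y => h t y i) x)
    (hhpos : ∀ t x, (∀ i, 0 ≤ x i) → ∀ i, 0 ≤ h t x i)
    (N : Fin d → ℝ)
    (hhbdd : ∀ t x, (∀ j, 0 ≤ x j) → ∀ i, |h t x i| ≤ N i)
    (hhper : ∀ t x, h (t + T) x = h t x)
    (L : ℝ) (hL0 : 0 ≤ L)
    (hLbound : ∀ t x, (∀ j, 0 ≤ x j) → ∀ i j,
      |fderiv ℝ (fun y => h t y i) x (Pi.single j 1)| ≤ L)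
    (𝓕 : Filtration ℝ mΩ)
    (hΦadapt : ∀ s t : ℝ, s ≤ t → ∀ i j,
      Measurable[𝓕 t] fun ω => Φ (t - s) (θ s ω) i j)
    (hΦprog : ∀ t : ℝ, ∀ i j,
      Measurable[MeasurableSpace.prod inferInstance (𝓕 t)]
        fun p : Set.Iic t × Ω => Φ (t - (p.1 : ℝ)) (θ (p.1 : ℝ) p.2) i j)
    (𝓕st : ℝ → ℝ → MeasurableSpace Ω)
    (h𝓕st_le : ∀ s t : ℝ, s ≤ t → 𝓕st s t ≤ 𝓕 t)
    (hindep : ∀ s t : ℝ, s ≤ t → ProbabilityTheory.Indep (𝓕st s t) (𝓕 s) ℙ)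
    (hRadapt : ∀ s t : ℝ, s ≤ t → Measurable[𝓕st s t] fun ω => R (t - s) (θ s ω))
    (hRint : ∀ t : ℝ, 0 ≤ t → Integrable (R t) ℙ)
    (S : ℝ) (hS : IsLUB {y : ℝ | ∃ t : ℝ, 0 ≤ t ∧ y = ∫ ω, R t ω ∂ℙ} S)
    (Mmem : (ℝ → Ω → (Fin d → ℝ)) → Prop)
    (hMmem : ∀ f, Mmem f ↔
      (ProgMeasurable 𝓕 f ∧ (∀ t ω i, 0 ≤ f t ω i ∧ f t ω i ≤ N i) ∧
        ∀ t ω, f (t + T) ω = f t (θ T ω)))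
    (ρ : (ℝ → Ω → (Fin d → ℝ)) → (ℝ → Ω → (Fin d → ℝ)) → ℝ)
    (hρ : ∀ f₁ f₂, ρ f₁ f₂ = ⨆ t : ℝ, ∫ ω, (⨆ i : Fin d, |f₁ t ω i - f₂ t ω i|) ∂ℙ) :
    (∀ f₁ f₂, Mmem f₁ → Mmem f₂ →
      ρ (fun t ω => h t (K f₁ t ω)) (fun t ω => h t (K f₂ t ω)) ≤
        L * (d : ℝ) ^ 2 / lam * S * ρ f₁ f₂) ∧
    (L * (d : ℝ) ^ 2 * S < lam →
      ∃ c : ℝ, 0 ≤ c ∧ c < 1 ∧ ∀ f₁ f₂, Mmem f₁ → Mmem f₂ →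
        ρ (fun t ω => h t (K f₁ t ω)) (fun t ω => h t (K f₂ t ω)) ≤ c * ρ f₁ f₂) := by
  have hES : ∀ t, 0 ≤ t → ∫ ω, R t ω ∂ℙ ≤ S := fun t ht => hS.1 ⟨t, ht, rfl⟩
  have hS0 : 0 ≤ S := (integral_nonneg fun ω => (hRpos 0 ω le_rfl).le).trans (hES 0 le_rfl)
  have hmain : ∀ f₁ f₂, Mmem f₁ → Mmem f₂ →
      ρ (fun t ω => h t (K f₁ t ω)) (fun t ω => h t (K f₂ t ω)) ≤
        L * (d : ℝ) ^ 2 / lam * S * ρ f₁ f₂ := by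
    intro f₁ f₂ hf₁ hf₂
    simp only [hMmem] at hf₁ hf₂
    have hnorm : ∀ f : ℝ → Ω → Fin d → ℝ, (∀ t ω i, 0 ≤ f t ω i ∧ f t ω i ≤ N i) → ∀ t ω, ‖f t ω‖ ≤ ‖N‖ :=
      fun f hf t ω => (pi_norm_le_iff_of_nonneg (norm_nonneg _)).2 fun i => by
        rw [Real.norm_of_nonneg (hf t ω i).1]
        exact (hf t ω i).2.trans ((le_abs_self _).trans (norm_le_pi_norm N i))
    have hDmeas : ∀ s, Measurable[𝓕 s] fun ω => ‖f₁ s ω - f₂ s ω‖ := fun s =>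
      ((IsStronglyProgressive.stronglyAdapted hf₁.1 s).sub
        (IsStronglyProgressive.stronglyAdapted hf₂.1 s)).norm.measurable
    have hDbound : ∀ s ω, ‖f₁ s ω - f₂ s ω‖ ≤ ‖N‖ + ‖N‖ := fun s ω =>
      (norm_sub_le _ _).trans (add_le_add (hnorm f₁ hf₁.2.1 s ω) (hnorm f₂ hf₂.2.1 s ω))
    have hDint : ∀ s, Integrable (fun ω => ‖f₁ s ω - f₂ s ω‖) ℙ := fun s =>
      (integrable_const (‖N‖ + ‖N‖)).mono' ((hDmeas s).mono (𝓕.le s) le_rfl).aestronglyMeasurable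
        (ae_of_all _ fun ω => by rw [norm_norm]; exact hDbound s ω)
    have hρf : ρ f₁ f₂ = ⨆ t : ℝ, ∫ ω, ‖f₁ t ω - f₂ t ω‖ ∂ℙ := by
      simp_rw [hρ, iSup_abs_sub_eq_norm]
    have hDρ : ∀ s, ∫ ω, ‖f₁ s ω - f₂ s ω‖ ∂ℙ ≤ ρ f₁ f₂ := by
      intro s
      rw [hρf]
      refine le_ciSup (f := fun s => ∫ ω, ‖f₁ s ω - f₂ s ω‖ ∂ℙ) ⟨‖N‖ + ‖N‖, ?_⟩ s
      rintro _ ⟨t, rfl⟩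
      refine (integral_mono (hDint t) (integrable_const _) (hDbound t)).trans ?_
      simp
    have hρ0 : 0 ≤ ρ f₁ f₂ := (integral_nonneg fun ω => norm_nonneg _).trans (hDρ 0)
    have hθs : ∀ ω, Measurable fun s => θ s ω := fun ω =>
      hθmeas.comp (measurable_id.prodMk measurable_const)
    have hKint : ∀ f : ℝ → Ω → Fin d → ℝ, IsStronglyProgressive 𝓕 f →
        (∀ t ω i, 0 ≤ f t ω i ∧ f t ω i ≤ N i) → ∀ t ω,
        IntegrableOn (fun s => (Φ (t - s) (θ s ω)).mulVec (f s ω)) (Set.Iic t) := by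
      intro f hf hfN t ω
      obtain ⟨C, hC⟩ := hRtemp (lam / 2) (half_pos hlam) ω
      refine integrableOn_Iic_mulVec hlam (B := ‖N‖) (C := C) (r := fun s => R (t - s) (θ s ω))
        (fun i j => ?_) ?_ (fun s => hnorm f hfN s ω)
        (fun s hs => (hRpos _ _ (sub_nonneg.2 hs)).le)
        (fun s hs => hΦbound _ _ (sub_nonneg.2 hs)) (fun s hs => hC s _ (sub_nonneg.2 hs))
      · exact (hΦmeas i j).comp ((measurable_const.sub measurable_id).prodMk (hθs ω))
      · have hm : Measurable fun s => f (min s t) ω :=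
          (IsStronglyProgressive.measurable_comp_min hf t).comp
            (measurable_id.prodMk measurable_const)
        refine hm.aestronglyMeasurable.congr ?_
        filter_upwards [ae_restrict_mem measurableSet_Iic] with s hs
        rw [min_eq_left (Set.mem_Iic.1 hs)]
    have hKpos : ∀ f : ℝ → Ω → Fin d → ℝ, IsStronglyProgressive 𝓕 f →
        (∀ t ω i, 0 ≤ f t ω i ∧ f t ω i ≤ N i) → ∀ t ω j,
        0 ≤ K f t ω j := by
      intro f hf hfN t ω j
      rw [hK, eval_integral fun i => (hKint f hf hfN t ω).eval i]
      refine setIntegral_nonneg measurableSet_Iic fun s hs => ?_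
      simp only [Matrix.mulVec, dotProduct]
      exact Finset.sum_nonneg fun k _ =>
        mul_nonneg (hΦpos _ _ (sub_nonneg.2 hs) _ _) (hfN s ω k).1
    have hpoint : ∀ t ω, ENNReal.ofReal ‖h t (K f₁ t ω) - h t (K f₂ t ω)‖ ≤
        ENNReal.ofReal (L * d ^ 2) * ∫⁻ s in Set.Iic t, ENNReal.ofReal (Real.exp (-lam * (t - s))) *
          (ENNReal.ofReal (R (t - s) (θ s ω)) * ENNReal.ofReal ‖f₁ s ω - f₂ s ω‖) := by
      intro t ω
      have hdiff : K f₁ t ω - K f₂ t ω =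
          ∫ s in Set.Iic t, (Φ (t - s) (θ s ω)).mulVec (f₁ s ω - f₂ s ω) := by
        simp_rw [hK, Matrix.mulVec_sub]
        exact (integral_sub (hKint f₁ hf₁.1 hf₁.2.1 t ω) (hKint f₂ hf₂.1 hf₂.2.1 t ω)).symm
      have hdiff_le : ENNReal.ofReal ‖K f₁ t ω - K f₂ t ω‖ ≤
          ∫⁻ s in Set.Iic t, ENNReal.ofReal d * (ENNReal.ofReal (Real.exp (-lam * (t - s))) *
            (ENNReal.ofReal (R (t - s) (θ s ω)) * ENNReal.ofReal ‖f₁ s ω - f₂ s ω‖)) := by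
        rw [hdiff, ofReal_norm]
        refine (enorm_integral_le_lintegral_enorm _).trans
          (setLIntegral_mono' measurableSet_Iic fun s hs => ?_)
        have hts : 0 ≤ t - s := sub_nonneg.2 hs
        have hR := (hRpos (t - s) (θ s ω) hts).le
        rw [← ofReal_norm, ← ENNReal.ofReal_mul hR, ← ENNReal.ofReal_mul (Real.exp_nonneg _),
          ← ENNReal.ofReal_mul (Nat.cast_nonneg d)]
        refine ENNReal.ofReal_le_ofReal ((norm_mulVec_le_of_abs_le (by positivity)
          (hΦbound _ _ hts) _).trans_eq ?_)
        ring
      rw [lintegral_const_mul' _ _ ENNReal.ofReal_ne_top] at hdiff_le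
      calc ENNReal.ofReal ‖h t (K f₁ t ω) - h t (K f₂ t ω)‖
          ≤ ENNReal.ofReal (L * d * ‖K f₁ t ω - K f₂ t ω‖) :=
            ENNReal.ofReal_le_ofReal (norm_sub_le_of_abs_fderiv_le hL0 (hhdiff t) (hLbound t)
              (hKpos f₁ hf₁.1 hf₁.2.1 t ω) (hKpos f₂ hf₂.1 hf₂.2.1 t ω))
        _ = ENNReal.ofReal (L * d) * ENNReal.ofReal ‖K f₁ t ω - K f₂ t ω‖ :=
            ENNReal.ofReal_mul (by positivity)
        _ ≤ _ := by
            refine (mul_le_mul_right hdiff_le _).trans_eq ?_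
            rw [← mul_assoc, ← ENNReal.ofReal_mul (by positivity)]
            congr 2
            ring
    have hRD : ∀ t s, s ≤ t → ∫⁻ ω, ENNReal.ofReal (R (t - s) (θ s ω)) *
        ENNReal.ofReal ‖f₁ s ω - f₂ s ω‖ ∂ℙ ≤ ENNReal.ofReal (S * ρ f₁ f₂) := by
      intro t s hst
      have hts : 0 ≤ t - s := sub_nonneg.2 hst
      rw [ProbabilityTheory.lintegral_mul_eq_lintegral_mul_lintegral_of_independent_measurableSpace
        ((h𝓕st_le s t hst).trans (𝓕.le t)) (𝓕.le s) (hindep s t hst)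
        (hRadapt s t hst).ennreal_ofReal (hDmeas s).ennreal_ofReal,
        ENNReal.ofReal_mul hS0]
      refine mul_le_mul' ?_ ?_
      · rw [(hθpres s).lintegral_comp (f := fun ω => ENNReal.ofReal (R (t - s) ω))
          (hRmeas.comp (measurable_const.prodMk measurable_id)).ennreal_ofReal,
          ← ofReal_integral_eq_lintegral_ofReal (hRint _ hts)
            (ae_of_all _ fun ω => (hRpos _ ω hts).le)]
        exact ENNReal.ofReal_le_ofReal (hES _ hts)
      · rw [← ofReal_integral_eq_lintegral_ofReal (hDint s) (ae_of_all _ fun ω => norm_nonneg _)]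
        exact ENNReal.ofReal_le_ofReal (hDρ s)
    have hfubini : ∀ t, ∫⁻ ω, (∫⁻ s in Set.Iic t, ENNReal.ofReal (Real.exp (-lam * (t - s))) *
          (ENNReal.ofReal (R (t - s) (θ s ω)) * ENNReal.ofReal ‖f₁ s ω - f₂ s ω‖)) ∂ℙ ≤
        ENNReal.ofReal (1 / lam) * ENNReal.ofReal (S * ρ f₁ f₂) := by
      intro t
      have hcongr : ∀ ω, ∫⁻ s in Set.Iic t, ENNReal.ofReal (Real.exp (-lam * (t - s))) *
            (ENNReal.ofReal (R (t - s) (θ s ω)) * ENNReal.ofReal ‖f₁ s ω - f₂ s ω‖) =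
          ∫⁻ s in Set.Iic t, ENNReal.ofReal (Real.exp (-lam * (t - s))) *
            (ENNReal.ofReal (R (t - s) (θ s ω)) *
              ENNReal.ofReal ‖f₁ (min s t) ω - f₂ (min s t) ω‖) := fun ω =>
        setLIntegral_congr_fun measurableSet_Iic fun s hs => by
          simp only [min_eq_left (Set.mem_Iic.1 hs)]
      have hRjoint : Measurable fun p : Ω × ℝ => R (t - p.2) (θ p.2 p.1) :=
        hRmeas.comp ((measurable_const.sub measurable_snd).prodMk (hθmeas.comp measurable_swap))
      have hDjoint : Measurable fun p : Ω × ℝ => ‖f₁ (min p.2 t) p.1 - f₂ (min p.2 t) p.1‖ :=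
        (((IsStronglyProgressive.measurable_comp_min hf₁.1 t).comp measurable_swap).sub
          ((IsStronglyProgressive.measurable_comp_min hf₂.1 t).comp measurable_swap)).norm
      have hexp : Measurable fun p : Ω × ℝ => Real.exp (-lam * (t - p.2)) := by fun_prop
      simp_rw [hcongr]
      rw [lintegral_lintegral_swap (hexp.ennreal_ofReal.mul
        (hRjoint.ennreal_ofReal.mul hDjoint.ennreal_ofReal)).aemeasurable]
      calc _ ≤ ∫⁻ s in Set.Iic t, ENNReal.ofReal (Real.exp (-lam * (t - s))) *
            ENNReal.ofReal (S * ρ f₁ f₂) := by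
            refine setLIntegral_mono' measurableSet_Iic fun s hs => ?_
            rw [lintegral_const_mul' _ _ ENNReal.ofReal_ne_top, min_eq_left (Set.mem_Iic.1 hs)]
            exact mul_le_mul_right (hRD t s hs) _
        _ = _ := by
            rw [lintegral_mul_const' _ _ ENNReal.ofReal_ne_top,
              lintegral_Iic_exp_neg_mul_sub hlam]
    simp_rw [hρ (fun t ω => h t (K f₁ t ω)), iSup_abs_sub_eq_norm]
    refine ciSup_le fun t => ?_
    have hrhs : 0 ≤ L * (d : ℝ) ^ 2 / lam * S * ρ f₁ f₂ := by positivity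
    by_cases hint : Integrable (fun ω => ‖h t (K f₁ t ω) - h t (K f₂ t ω)‖) ℙ
    · rw [← ENNReal.ofReal_le_ofReal_iff hrhs,
        ofReal_integral_eq_lintegral_ofReal hint (ae_of_all _ fun ω => norm_nonneg _)]
      refine (lintegral_mono (hpoint t)).trans ?_
      rw [lintegral_const_mul' _ _ ENNReal.ofReal_ne_top]
      refine (mul_le_mul_right (hfubini t) _).trans_eq ?_
      rw [← ENNReal.ofReal_mul (by positivity), ← ENNReal.ofReal_mul (by positivity)]
      congr 1
      ring
    · rw [integral_undef hint]
      exact hrhs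
  refine ⟨hmain, fun hlt => ⟨L * (d : ℝ) ^ 2 / lam * S, by positivity, ?_, hmain⟩⟩
  rwa [div_mul_eq_mul_div, div_lt_one hlam]
end

section
/- For all s ≤ t, x ∈ [0,∞)ᵈ and ω ∈ Ω, φ(t+T, s+T, ω)x = φ(t, s, θ_T ω)x; i.e. the solution flow of the T-periodic integral equation is T-periodic in the sense of random dynamical systems. -/
/-- T-periodicity of the solution flow of the T-periodic integral equation: if for every
`s`, `ω` and nonnegative `x` the integral equation
`ψ(t) = Φ(t−s, θ_s ω)x + ∫_s^t Φ(t−r, θ_r ω) h(r, ψ(r)) dr`, `t ≥ s`, has a unique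
continuous nonnegative solution `ψ = φ(·, s, ω)x`, and `h(t+T, x) = h(t, x)`, then
`φ(t+T, s+T, ω)x = φ(t, s, θ_T ω)x` for all `s ≤ t`, nonnegative `x` and `ω`. -/
theorem stmt_10 {Ω : Type*} (θ : ℝ → Ω → Ω) (hθ0 : θ 0 = id)
    (hθadd : ∀ s t : ℝ, θ (t + s) = θ t ∘ θ s)
    (d : ℕ) (hd : 1 ≤ d) (T : ℝ) (hT : 0 < T)
    (Φ : ℝ → Ω → Matrix (Fin d) (Fin d) ℝ)
    (h : ℝ → (Fin d → ℝ) → (Fin d → ℝ))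
    (hhcont : Continuous fun p : ℝ × (Fin d → ℝ) => h p.1 p.2)
    (hhpos : ∀ t x, (∀ i, 0 ≤ x i) → ∀ i, 0 ≤ h t x i)
    (hhper : ∀ t x, h (t + T) x = h t x)
    (φ : ℝ → ℝ → Ω → (Fin d → ℝ) → (Fin d → ℝ))
    (hφcont : ∀ (s : ℝ) (ω : Ω) (x : Fin d → ℝ), (∀ i, 0 ≤ x i) →
      ContinuousOn (fun t => φ t s ω x) (Set.Ici s))
    (hφpos : ∀ (s t : ℝ) (ω : Ω) (x : Fin d → ℝ), s ≤ t → (∀ i, 0 ≤ x i) →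
      ∀ i, 0 ≤ φ t s ω x i)
    (hφsol : ∀ (s t : ℝ) (ω : Ω) (x : Fin d → ℝ), s ≤ t → (∀ i, 0 ≤ x i) →
      φ t s ω x = (Φ (t - s) (θ s ω)).mulVec x +
        ∫ r in s..t, (Φ (t - r) (θ r ω)).mulVec (h r (φ r s ω x)))
    (hφuniq : ∀ (s : ℝ) (ω : Ω) (x : Fin d → ℝ) (ψ : ℝ → Fin d → ℝ), (∀ i, 0 ≤ x i) →
      ContinuousOn ψ (Set.Ici s) →
      (∀ t, s ≤ t → (∀ i, 0 ≤ ψ t i) ∧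
        ψ t = (Φ (t - s) (θ s ω)).mulVec x +
          ∫ r in s..t, (Φ (t - r) (θ r ω)).mulVec (h r (ψ r))) →
      ∀ t, s ≤ t → ψ t = φ t s ω x) :
    ∀ (s t : ℝ) (ω : Ω) (x : Fin d → ℝ), s ≤ t → (∀ i, 0 ≤ x i) →
      φ (t + T) (s + T) ω x = φ t s (θ T ω) x := by
  intro s t ω x hst hx
  have hshift : ∀ r, θ r (θ T ω) = θ (r + T) ω := fun r => by
    rw [hθadd T r, Function.comp_apply]
  refine hφuniq s (θ T ω) x (fun t => φ (t + T) (s + T) ω x) hx ?_ ?_ t hst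
  · refine (hφcont (s + T) ω x hx).comp (by fun_prop) fun r hr => ?_
    simpa using hr
  · intro u hu
    have hu' : s + T ≤ u + T := by linarith
    refine ⟨hφpos _ _ ω x hu' hx, ?_⟩
    rw [hφsol (s + T) (u + T) ω x hu' hx, hshift, add_sub_add_right_eq_sub,
      ← intervalIntegral.integral_comp_add_right]
    simp only [hshift, hhper, add_sub_add_right_eq_sub]
end

section
/- Let W : ℝ → ℝ be continuous with W(t)/|t| → 0 as t → ±∞, and let c > 0 and σ ∈ ℝ. Then for every γ > 0, sup_{t∈ℝ} ( e^{−γ|t|} · sup_{s≥0} exp(−c·s + σ·(W(s+t) − W(t))) ) < ∞. -/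
/-- A continuous function of sublinear growth at `±∞` is bounded by `ε * |t| + M`, for every
slope `ε > 0`. -/
theorem exists_abs_le_mul_abs_add {W : ℝ → ℝ} (hW : Continuous W)
    (hWtop : Filter.Tendsto (fun t => W t / |t|) Filter.atTop (nhds 0))
    (hWbot : Filter.Tendsto (fun t => W t / |t|) Filter.atBot (nhds 0))
    {ε : ℝ} (hε : 0 < ε) : ∃ M : ℝ, ∀ t, |W t| ≤ ε * |t| + M := by
  have of_quotient_mem : ∀ t : ℝ, t ≠ 0 → W t / |t| ∈ Metric.ball 0 ε → |W t| ≤ ε * |t| := by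
    intro t ht h
    rw [mem_ball_zero_iff, Real.norm_eq_abs, abs_div, abs_abs, div_lt_iff₀ (abs_pos.2 ht)] at h
    exact h.le
  obtain ⟨b, hb⟩ := Filter.eventually_atTop.1
    ((hWtop.eventually (Metric.ball_mem_nhds 0 hε)).and (Filter.eventually_ne_atTop 0))
  obtain ⟨a, ha⟩ := Filter.eventually_atBot.1
    ((hWbot.eventually (Metric.ball_mem_nhds 0 hε)).and (Filter.eventually_ne_atBot 0))
  obtain ⟨M, hM⟩ := (isCompact_Icc (a := a) (b := b)).exists_bound_of_continuousOn hW.continuousOn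
  refine ⟨max M 0, fun t => ?_⟩
  rcases le_total t a with hta | hta
  · linarith [of_quotient_mem t (ha t hta).2 (ha t hta).1, le_max_right M 0]
  rcases le_total b t with htb | htb
  · linarith [of_quotient_mem t (hb t htb).2 (hb t htb).1, le_max_right M 0]
  · have hWt : |W t| ≤ M := hM t ⟨hta, htb⟩
    linarith [mul_nonneg hε.le (abs_nonneg t), le_max_left M 0]

/-- Temperedness, for a fixed sample path, of `sup_{s ≥ 0} exp(−c·s + σ·W_s)` along the
orbit of the Wiener shift: if `W : ℝ → ℝ` is continuous with `W(t)/|t| → 0` as `t → ±∞`,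
`c > 0` and `σ ∈ ℝ`, then for every `γ > 0`,
`sup_{t∈ℝ} ( e^{−γ|t|} · sup_{s≥0} exp(−c·s + σ·(W(s+t) − W(t))) ) < ∞`. -/
theorem stmt_12 (W : ℝ → ℝ) (hW : Continuous W)
    (hWtop : Filter.Tendsto (fun t => W t / |t|) Filter.atTop (nhds 0))
    (hWbot : Filter.Tendsto (fun t => W t / |t|) Filter.atBot (nhds 0))
    (c : ℝ) (hc : 0 < c) (σ : ℝ) :
    ∀ γ : ℝ, 0 < γ → ∃ C : ℝ, ∀ t s : ℝ, 0 ≤ s →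
      Real.exp (-γ * |t|) * Real.exp (-c * s + σ * (W (s + t) - W t)) ≤ C := by
  intro γ hγ
  have hσ : 0 < |σ| + 1 := by positivity
  have hm : 0 < min c (γ / 2) := lt_min hc (half_pos hγ)
  obtain ⟨M, hM⟩ := exists_abs_le_mul_abs_add hW hWtop hWbot (div_pos hm hσ)
  set ε := min c (γ / 2) / (|σ| + 1)
  have hε0 : 0 < ε := div_pos hm hσ
  have hσε : |σ| * ε ≤ min c (γ / 2) := by
    have : (|σ| + 1) * ε = min c (γ / 2) := mul_div_cancel₀ _ hσ.ne'
    linarith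
  refine ⟨Real.exp (2 * |σ| * M), fun t s hs => ?_⟩
  rw [← Real.exp_add, Real.exp_le_exp]
  have hincr : |W (s + t) - W t| ≤ ε * (s + 2 * |t|) + 2 * M := by
    have hst : |s + t| ≤ s + |t| := (abs_add_le s t).trans_eq (by rw [abs_of_nonneg hs])
    linarith [abs_sub (W (s + t)) (W t), hM (s + t), hM t, mul_le_mul_of_nonneg_left hst hε0.le]
  have hσincr : σ * (W (s + t) - W t) ≤ |σ| * (ε * (s + 2 * |t|) + 2 * M) :=
    (le_abs_self _).trans ((abs_mul _ _).trans_le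
      (mul_le_mul_of_nonneg_left hincr (abs_nonneg σ)))
  have hcs := mul_le_mul_of_nonneg_right (hσε.trans (min_le_left _ _)) hs
  have hγt := mul_le_mul_of_nonneg_right (hσε.trans (min_le_right _ _)) (abs_nonneg t)
  linarith
end

section
/- Let λ > 0 and A, B : [0,∞) × ℝ → [0,∞) be functions such that for every γ > 0, M_A(γ) := sup_{t∈ℝ} e^{−γ|t|} sup_{s≥0} A(s, t) < ∞ and M_B(γ) := sup_{t∈ℝ} e^{−γ|t|} sup_{s≥0} B(s, t) < ∞, and such that for all s ≥ 0, t ∈ ℝ the map r ↦ A(s−r, r+t)·B(r, t) is measurable on [0, s]. Define C(s, t) := ∫_0^s e^{−λr} A(s−r, r+t) B(r, t) dr. Then for every γ > 0, sup_{t∈ℝ} e^{−γ|t|} sup_{s≥0} C(s, t) < ∞. -/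
/-- The exponential weight `e^{-cr}` has mass at most `c⁻¹` on every interval `[0, s]`. -/
theorem intervalIntegral_exp_neg_mul_le {c : ℝ} (hc : 0 < c) (s : ℝ) :
    ∫ r in (0 : ℝ)..s, Real.exp (-c * r) ≤ c⁻¹ := by
  have hval : ∫ r in (0 : ℝ)..s, Real.exp (-c * r) = c⁻¹ * (1 - Real.exp (-c * s)) := by
    rw [intervalIntegral.integral_comp_mul_left (fun x => Real.exp x) (neg_ne_zero.mpr hc.ne'),
      integral_exp, mul_zero, Real.exp_zero, smul_eq_mul, inv_neg]
    ring
  rw [hval]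
  exact mul_le_of_le_one_right (inv_nonneg.mpr hc.le) (by linarith [Real.exp_pos (-c * s)])

/-- A weighted bound `e^{-δ|t|} x ≤ M` gives `x ≤ M e^{δ|t|}`. -/
theorem le_mul_exp_of_exp_neg_mul_le {δ t x M : ℝ} (h : Real.exp (-δ * |t|) * x ≤ M) :
    x ≤ M * Real.exp (δ * |t|) := by
  rw [neg_mul, Real.exp_neg, inv_mul_le_iff₀ (Real.exp_pos _)] at h
  linarith

/-- Temperedness is preserved under the exponentially weighted convolution
`C(s,t) := ∫_0^s e^{−λr} A(s−r, r+t) B(r, t) dr`: if for every `γ > 0` both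
`sup_{t} e^{−γ|t|} sup_{s≥0} A(s,t)` and `sup_{t} e^{−γ|t|} sup_{s≥0} B(s,t)` are finite,
then so is `sup_{t} e^{−γ|t|} sup_{s≥0} C(s,t)`. -/
theorem stmt_13 (lam : ℝ) (hlam : 0 < lam)
    (A B : ℝ → ℝ → ℝ)
    (hA0 : ∀ s t : ℝ, 0 ≤ s → 0 ≤ A s t) (hB0 : ∀ s t : ℝ, 0 ≤ s → 0 ≤ B s t)
    (hAtemp : ∀ γ : ℝ, 0 < γ → ∃ M : ℝ, ∀ t s : ℝ, 0 ≤ s → Real.exp (-γ * |t|) * A s t ≤ M)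
    (hBtemp : ∀ γ : ℝ, 0 < γ → ∃ M : ℝ, ∀ t s : ℝ, 0 ≤ s → Real.exp (-γ * |t|) * B s t ≤ M)
    (hABmeas : ∀ s t : ℝ, 0 ≤ s →
      AEMeasurable (fun r => A (s - r) (r + t) * B r t)
        (MeasureTheory.volume.restrict (Set.Icc (0 : ℝ) s)))
    (C : ℝ → ℝ → ℝ)
    (hC : ∀ s t : ℝ, 0 ≤ s →
      C s t = ∫ r in (0:ℝ)..s, Real.exp (-lam * r) * A (s - r) (r + t) * B r t) :
    ∀ γ : ℝ, 0 < γ → ∃ M : ℝ, ∀ t s : ℝ, 0 ≤ s → Real.exp (-γ * |t|) * C s t ≤ M := by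
  intro γ hγ
  obtain ⟨δ, hδ, hδγ, hδlam⟩ : ∃ δ : ℝ, 0 < δ ∧ 2 * δ ≤ γ ∧ 2 * δ ≤ lam :=
    ⟨min γ lam / 2, half_pos (lt_min hγ hlam), by linarith [min_le_left γ lam],
      by linarith [min_le_right γ lam]⟩
  obtain ⟨MA, hMA⟩ := hAtemp δ hδ
  obtain ⟨MB, hMB⟩ := hBtemp δ hδ
  have hMA0 : 0 ≤ MA :=
    (mul_nonneg (Real.exp_pos _).le (hA0 0 0 le_rfl)).trans (hMA 0 0 le_rfl)
  have hMB0 : 0 ≤ MB :=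
    (mul_nonneg (Real.exp_pos _).le (hB0 0 0 le_rfl)).trans (hMB 0 0 le_rfl)
  refine ⟨MA * MB * (lam / 2)⁻¹, fun t s hs => ?_⟩
  have hpoint : ∀ r ∈ Set.Ioc (0 : ℝ) s,
      ‖Real.exp (-lam * r) * A (s - r) (r + t) * B r t‖ ≤
        MA * MB * Real.exp (γ * |t|) * Real.exp (-(lam / 2) * r) := by
    rintro r ⟨hr0, hrs⟩
    have hsr : 0 ≤ s - r := sub_nonneg.mpr hrs
    have hA := le_mul_exp_of_exp_neg_mul_le (hMA (r + t) (s - r) hsr)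
    have hB := le_mul_exp_of_exp_neg_mul_le (hMB t r hr0.le)
    have hA' := hA0 (s - r) (r + t) hsr
    have hB' := hB0 r t hr0.le
    have habs : |r + t| ≤ r + |t| := by
      simpa [abs_of_pos hr0] using abs_add_le r t
    rw [Real.norm_of_nonneg (by positivity)]
    calc Real.exp (-lam * r) * A (s - r) (r + t) * B r t
        ≤ Real.exp (-lam * r) * (MA * Real.exp (δ * |r + t|)) * (MB * Real.exp (δ * |t|)) := by
          gcongr
      _ = MA * MB * Real.exp (-lam * r + δ * |r + t| + δ * |t|) := by
          rw [Real.exp_add, Real.exp_add]; ring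
      _ ≤ MA * MB * Real.exp (γ * |t| + -(lam / 2) * r) := by
          refine mul_le_mul_of_nonneg_left (Real.exp_le_exp.mpr ?_) (by positivity)
          nlinarith [mul_le_mul_of_nonneg_left habs hδ.le,
            mul_le_mul_of_nonneg_right hδγ (abs_nonneg t),
            mul_le_mul_of_nonneg_right hδlam hr0.le]
      _ = _ := by rw [Real.exp_add]; ring
  have hCle : C s t ≤ MA * MB * Real.exp (γ * |t|) * (lam / 2)⁻¹ := by
    rw [hC s t hs]
    calc _ ≤ ∫ r in (0 : ℝ)..s, MA * MB * Real.exp (γ * |t|) * Real.exp (-(lam / 2) * r) :=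
          (Real.le_norm_self _).trans
            (intervalIntegral.norm_integral_le_of_norm_le hs (.of_forall hpoint)
              (Continuous.intervalIntegrable (by fun_prop) _ _))
      _ ≤ _ := by
          rw [intervalIntegral.integral_const_mul]
          exact mul_le_mul_of_nonneg_left (intervalIntegral_exp_neg_mul_le (half_pos hlam) s)
            (by positivity)
  rw [neg_mul, Real.exp_neg, inv_mul_le_iff₀ (Real.exp_pos _)]
  linarith
end

section
/- For all 1 ≤ j ≤ i ≤ n, t ≥ 0 and ω ∈ Ω, Φ_{ij}(t, ω) ≤ e^{−(n+1−i)λt} · R_{ij}(t, ω). -/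
open MeasureTheory

/-- Pathwise bound for the off-diagonal entries of the fundamental matrix of a
triangular linear system: if `Φ_{ii}(t,ω) ≤ R_{ii}(t,ω)·e^{−(n+1−i)λt}` on the diagonal
and `Φ_{ij}`, `R_{ij}` are defined by the recursions
`Φ_{ij}(t,ω) = ∫_0^t Φ_{ii}(t−s, θ_s ω) Φ_{i−1,j}(s,ω) ds` and
`R_{ij}(t,ω) = ∫_0^t e^{−λs} R_{ii}(t−s, θ_s ω) R_{i−1,j}(s,ω) ds`,
then `Φ_{ij}(t,ω) ≤ e^{−(n+1−i)λt}·R_{ij}(t,ω)` for all `1 ≤ j ≤ i ≤ n`, `t ≥ 0`, `ω`. -/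
theorem stmt_14 {Ω : Type*} (n : ℕ) (hn : 1 ≤ n) (lam : ℝ) (hlam : 0 < lam)
    (θ : ℝ → Ω → Ω)
    (Φ R : ℕ → ℕ → ℝ → Ω → ℝ)
    (hΦ0 : ∀ i, 1 ≤ i → i ≤ n → ∀ t (ω : Ω), 0 ≤ t → 0 ≤ Φ i i t ω)
    (hR0 : ∀ i, 1 ≤ i → i ≤ n → ∀ t (ω : Ω), 0 ≤ t → 0 ≤ R i i t ω)
    (hdiag : ∀ i, 1 ≤ i → i ≤ n → ∀ t (ω : Ω), 0 ≤ t →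
      Φ i i t ω ≤ R i i t ω * Real.exp (-(((n : ℝ) + 1 - (i : ℝ)) * lam * t)))
    (hΦrec : ∀ i j, 1 ≤ j → j < i → i ≤ n → ∀ t (ω : Ω), 0 ≤ t →
      Φ i j t ω = ∫ s in (0:ℝ)..t, Φ i i (t - s) (θ s ω) * Φ (i - 1) j s ω)
    (hRrec : ∀ i j, 1 ≤ j → j < i → i ≤ n → ∀ t (ω : Ω), 0 ≤ t →
      R i j t ω = ∫ s in (0:ℝ)..t, Real.exp (-lam * s) * R i i (t - s) (θ s ω) * R (i - 1) j s ω)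
    (hΦint : ∀ i j, 1 ≤ j → j < i → i ≤ n → ∀ t (ω : Ω), 0 ≤ t →
      IntervalIntegrable (fun s => Φ i i (t - s) (θ s ω) * Φ (i - 1) j s ω) volume 0 t)
    (hRint : ∀ i j, 1 ≤ j → j < i → i ≤ n → ∀ t (ω : Ω), 0 ≤ t →
      IntervalIntegrable (fun s => Real.exp (-lam * s) * R i i (t - s) (θ s ω) * R (i - 1) j s ω)
        volume 0 t) :
    ∀ i j, 1 ≤ j → j ≤ i → i ≤ n → ∀ t (ω : Ω), 0 ≤ t →
      Φ i j t ω ≤ Real.exp (-(((n : ℝ) + 1 - (i : ℝ)) * lam * t)) * R i j t ω := by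
  intro i j hj hji
  suffices h : i ≤ n → ∀ t (ω : Ω), 0 ≤ t → 0 ≤ Φ i j t ω ∧
      Φ i j t ω ≤ Real.exp (-(((n : ℝ) + 1 - (i : ℝ)) * lam * t)) * R i j t ω from
    fun hi t ω ht => (h hi t ω ht).2
  induction i, hji using Nat.le_induction with
  | base =>
    intro hjn t ω ht
    exact ⟨hΦ0 j hj hjn t ω ht, (hdiag j hj hjn t ω ht).trans_eq (mul_comm _ _)⟩
  | succ i hji ih =>
    intro hi t ω ht
    have hlt : j < i + 1 := Nat.lt_succ_of_le hji
    have hi1 : 1 ≤ i + 1 := Nat.le_add_left 1 i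
    have ih' := ih (Nat.le_of_succ_le hi)
    rw [hΦrec (i + 1) j hj hlt hi t ω ht, hRrec (i + 1) j hj hlt hi t ω ht,
      ← intervalIntegral.integral_const_mul]
    refine ⟨intervalIntegral.integral_nonneg ht fun s hs =>
        mul_nonneg (hΦ0 _ hi1 hi _ _ (sub_nonneg.2 hs.2)) (ih' s ω hs.1).1,
      intervalIntegral.integral_mono_on ht (hΦint (i + 1) j hj hlt hi t ω ht)
        ((hRint (i + 1) j hj hlt hi t ω ht).const_mul _) fun s hs => ?_⟩
    have hts : 0 ≤ t - s := sub_nonneg.2 hs.2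
    have hexp : Real.exp (-(((n : ℝ) + 1 - ((i + 1 : ℕ) : ℝ)) * lam * (t - s))) *
          Real.exp (-(((n : ℝ) + 1 - (i : ℝ)) * lam * s)) =
        Real.exp (-(((n : ℝ) + 1 - ((i + 1 : ℕ) : ℝ)) * lam * t)) * Real.exp (-lam * s) := by
      rw [← Real.exp_add, ← Real.exp_add]
      push_cast
      ring_nf
    rw [Nat.add_sub_cancel]
    refine (mul_le_mul (hdiag (i + 1) hi1 hi (t - s) (θ s ω) hts) (ih' s ω hs.1).2
      (ih' s ω hs.1).1 (mul_nonneg (hR0 _ hi1 hi _ _ hts) (Real.exp_pos _).le)).trans_eq ?_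
    linear_combination R (i + 1) (i + 1) (t - s) (θ s ω) * R i j s ω * hexp
end

section
/- The supremum over all t ∈ ℝ and x ≥ 0 of ((2 + sin t)·x²) / (4·(3 + sin t + x³)²) equals 1/(24·2^{1/3}); moreover the supremum is attained at any t with sin t = 1 together with x = 2^{1/3}. -/
/-- The difference of the two sides is
`(a + 2 * y ^ 3 - 6 * y ^ 2) ^ 2 + 12 * y ^ 2 * (y - 1) ^ 2 * (2 * y + 1)`. -/
lemma twelve_mul_sub_one_mul_sq_le (a : ℝ) {y : ℝ} (hy : 0 ≤ y) :
    12 * (a - 1) * y ^ 2 ≤ (a + 2 * y ^ 3) ^ 2 := by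
  have h : 0 ≤ (a + 2 * y ^ 3 - 6 * y ^ 2) ^ 2 + 12 * y ^ 2 * (y - 1) ^ 2 * (2 * y + 1) := by
    positivity
  linarith

/-- The supremum over `t ∈ ℝ` and `x ≥ 0` of `((2 + sin t)·x²)/(4·(3 + sin t + x³)²)`
equals `1/(24·2^(1/3))`, and it is attained at any `t` with `sin t = 1` together with
`x = 2^(1/3)`. -/
theorem stmt_19 :
    IsGreatest {y : ℝ | ∃ t x : ℝ, 0 ≤ x ∧
        y = (2 + Real.sin t) * x ^ 2 / (4 * (3 + Real.sin t + x ^ 3) ^ 2)}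
      (1 / (24 * (2 : ℝ) ^ ((1 : ℝ) / 3))) ∧
    ∀ t : ℝ, Real.sin t = 1 →
      (2 + Real.sin t) * ((2 : ℝ) ^ ((1 : ℝ) / 3)) ^ 2 /
          (4 * (3 + Real.sin t + ((2 : ℝ) ^ ((1 : ℝ) / 3)) ^ 3) ^ 2) =
        1 / (24 * (2 : ℝ) ^ ((1 : ℝ) / 3)) := by
  set c : ℝ := (2 : ℝ) ^ ((1 : ℝ) / 3) with hc
  have hc0 : 0 < c := by positivity
  have hc3 : c ^ 3 = 2 := by
    rw [hc, ← Real.rpow_natCast, ← Real.rpow_mul (by norm_num)]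
    norm_num
  have attained : ∀ t : ℝ, Real.sin t = 1 →
      (2 + Real.sin t) * c ^ 2 / (4 * (3 + Real.sin t + c ^ 3) ^ 2) = 1 / (24 * c) := by
    intro t ht
    rw [ht, hc3, div_eq_div_iff (by norm_num) (by positivity)]
    linear_combination 72 * hc3
  refine ⟨⟨⟨Real.pi / 2, c, hc0.le, (attained _ Real.sin_pi_div_two).symm⟩, ?_⟩, attained⟩
  rintro _ ⟨t, x, hx, rfl⟩
  have hsin := Real.neg_one_le_sin t
  have hpos : 0 < 3 + Real.sin t + x ^ 3 := by
    have := pow_nonneg hx 3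
    linarith
  obtain ⟨y, hy, rfl⟩ : ∃ y, 0 ≤ y ∧ x = c * y := ⟨x / c, by positivity, by field_simp⟩
  rw [div_le_div_iff₀ (by positivity) (by positivity), mul_pow c y 3, hc3]
  have key := twelve_mul_sub_one_mul_sq_le (3 + Real.sin t) hy
  linear_combination 4 * key + 24 * (2 + Real.sin t) * y ^ 2 * hc3
end
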